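/- Fix k ∈ ℒ and assume I − Q_{1:k−1,1:k−1} is invertible. Define w_{1:k−1,k} = (I − Q_{1:k−1,1:k−1})^{−1} Q_{1:k−1,k}, set u_L^{(k)} = (w_{1k},…,w_{k−1,k}, 1, 0,…,0)ᵀ ∈ ℝ^J, and u^{(k)} ∈ ℝ^K with ℒ-block u_L^{(k)} and ℋ-block u_H^{(k)} = −A_H^{−⊤} A_{LH}ᵀ u_L^{(k)}. Then diag(μ)(I − P) u^{(k)} = Cᵀ diag(μ_L) (I − Q) u_L^{(k)}, and equivalently u^{(k)} = (I − P)^{−1} M Cᵀ diag(μ_L) (I − Q) u_L^{(k)}, where μ_L = (μ_1,…,μ_J) and diag(μ_L) is the J×J diagonal matrix with these entries. -/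

import Mathlib

open Matrix

/-- Embedding of the lowest-priority classes `ℒ = {1,…,J}` into the classes `𝒦 = {1,…,K}`. -/
def emb {K J : ℕ} (hJK : J ≤ K) (j : Fin J) : Fin K := Fin.castLE hJK j

/-- The set `ℋ = {J+1,…,K}` of higher-priority classes, as a subtype of `Fin K`. -/
abbrev Hty (K J : ℕ) := {l : Fin K // J ≤ (l : ℕ)}

/-- The matrix `B` with `B_{k,k⁺} = 1` and all other entries `0`: entry `(i, c)` is `1`
iff `c ∈ ℋ` and `i = c⁻ = prev c`. -/
def Bmat (K J : ℕ) (prev : Fin K → Fin K) : Matrix (Fin K) (Fin K) ℝ :=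
  Matrix.of fun i c => if J ≤ (c : ℕ) ∧ prev c = i then 1 else 0

/-- `A = (I - Pᵀ) diag(μ) (I - B)`. -/
noncomputable def Amat (K J : ℕ) (P : Matrix (Fin K) (Fin K) ℝ) (μ : Fin K → ℝ)
    (prev : Fin K → Fin K) : Matrix (Fin K) (Fin K) ℝ :=
  (1 - Pᵀ) * Matrix.diagonal μ * (1 - Bmat K J prev)

/-- The `(ℋ,ℋ)` block `A_H` of `A`. -/
noncomputable def AHmat (K J : ℕ) (P : Matrix (Fin K) (Fin K) ℝ) (μ : Fin K → ℝ)
    (prev : Fin K → Fin K) : Matrix (Hty K J) (Hty K J) ℝ :=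
  Matrix.of fun i j => Amat K J P μ prev i j

/-- The `(ℒ,ℋ)` block `A_{LH}` of `A`. -/
noncomputable def ALHmat {K J : ℕ} (hJK : J ≤ K) (P : Matrix (Fin K) (Fin K) ℝ)
    (μ : Fin K → ℝ) (prev : Fin K → Fin K) : Matrix (Fin J) (Hty K J) ℝ :=
  Matrix.of fun i j => Amat K J P μ prev (emb hJK i) j

/-- The `(ℋ,ℒ)` block `A_{HL}` of `A`. -/
noncomputable def AHLmat {K J : ℕ} (hJK : J ≤ K) (P : Matrix (Fin K) (Fin K) ℝ)
    (μ : Fin K → ℝ) (prev : Fin K → Fin K) : Matrix (Hty K J) (Fin J) ℝ :=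
  Matrix.of fun i j => Amat K J P μ prev i (emb hJK j)

/-- The `(ℒ,ℒ)` block `A_L` of `A`. -/
noncomputable def ALmat {K J : ℕ} (hJK : J ≤ K) (P : Matrix (Fin K) (Fin K) ℝ)
    (μ : Fin K → ℝ) (prev : Fin K → Fin K) : Matrix (Fin J) (Fin J) ℝ :=
  Matrix.of fun i j => Amat K J P μ prev (emb hJK i) (emb hJK j)

/-- `Q = P_L - P_{LH} A_H^{-⊤} A_{LH}ᵀ`. -/
noncomputable def Qmat {K J : ℕ} (hJK : J ≤ K) (P : Matrix (Fin K) (Fin K) ℝ)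
    (μ : Fin K → ℝ) (prev : Fin K → Fin K) : Matrix (Fin J) (Fin J) ℝ :=
  (Matrix.of fun i j => P (emb hJK i) (emb hJK j)) -
    (Matrix.of fun (i : Fin J) (h : Hty K J) => P (emb hJK i) h) *
      ((AHmat K J P μ prev)⁻¹)ᵀ * (ALHmat hJK P μ prev)ᵀ

/-- The principal submatrix `Q_{1:k-1,1:k-1}` (indices strictly below `k`). -/
noncomputable def Qlow {J : ℕ} (Q : Matrix (Fin J) (Fin J) ℝ) (k : Fin J) :
    Matrix {i : Fin J // i < k} {i : Fin J // i < k} ℝ :=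
  Matrix.of fun i j => Q i j

/-- `w_{1:k-1,k} = (I - Q_{1:k-1,1:k-1})⁻¹ Q_{1:k-1,k}`. -/
noncomputable def wLow {J : ℕ} (Q : Matrix (Fin J) (Fin J) ℝ) (k : Fin J) :
    {i : Fin J // i < k} → ℝ :=
  ((1 - Qlow Q k)⁻¹).mulVec fun j => Q j k

/-- `w_{jk} = Q_{jk} + Q_{j,1:k-1}(I - Q_{1:k-1,1:k-1})⁻¹ Q_{1:k-1,k}` (rows `j = k,…,J`). -/
noncomputable def wHigh {J : ℕ} (Q : Matrix (Fin J) (Fin J) ℝ) (k : Fin J) (j : Fin J) : ℝ :=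
  Q j k + ∑ l : {l : Fin J // l < k}, Q j l * wLow Q k l

/-- `u_L^{(k)} = (w_{1k},…,w_{k-1,k}, 1, 0,…,0)ᵀ ∈ ℝ^J`. -/
noncomputable def uLvec {J : ℕ} (Q : Matrix (Fin J) (Fin J) ℝ) (k : Fin J) : Fin J → ℝ :=
  fun i => if h : i < k then wLow Q k ⟨i, h⟩ else if i = k then 1 else 0

/-- `u_H^{(k)} = -A_H^{-⊤} A_{LH}ᵀ u_L^{(k)}`, for a given `ℒ`-block `uL`. -/
noncomputable def uHvec {K J : ℕ} (hJK : J ≤ K) (P : Matrix (Fin K) (Fin K) ℝ)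
    (μ : Fin K → ℝ) (prev : Fin K → Fin K) (uL : Fin J → ℝ) : Hty K J → ℝ :=
  -(((AHmat K J P μ prev)⁻¹)ᵀ.mulVec ((ALHmat hJK P μ prev)ᵀ.mulVec uL))

/-- The vector `u ∈ ℝ^K` with `ℒ`-block `uL` and `ℋ`-block `-A_H^{-⊤} A_{LH}ᵀ uL`. -/
noncomputable def uvec {K J : ℕ} (hJK : J ≤ K) (P : Matrix (Fin K) (Fin K) ℝ)
    (μ : Fin K → ℝ) (prev : Fin K → Fin K) (uL : Fin J → ℝ) : Fin K → ℝ :=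
  fun l => if h : (l : ℕ) < J then uL ⟨l, h⟩
    else uHvec hJK P μ prev uL ⟨l, Nat.le_of_not_lt h⟩

/-- The constituency matrix `C`, with `C_{jk} = 1` iff `s(k) = j`. -/
def Cmat (K J : ℕ) (s : Fin K → Fin J) : Matrix (Fin J) (Fin K) ℝ :=
  Matrix.of fun j l => if s l = j then 1 else 0

theorem sum_eq_sum_emb_add_sum_Hty {K J : ℕ} (hJK : J ≤ K) (f : Fin K → ℝ) :
    ∑ l, f l = ∑ j : Fin J, f (emb hJK j) + ∑ h : Hty K J, f h := by
  rw [← Fintype.sum_subtype_add_sum_subtype (fun l : Fin K => (l : ℕ) < J) f]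
  congr 1
  · exact Fintype.sum_equiv
      ⟨fun l => ⟨l.1, l.2⟩, fun j => ⟨emb hJK j, j.2⟩, fun _ => rfl, fun _ => rfl⟩ _ _
      fun _ => rfl
  · exact Fintype.sum_equiv (Equiv.subtypeEquivRight fun _ => not_lt) _ _ fun _ => rfl

section

variable {K J : ℕ} (hJK : J ≤ K) (P : Matrix (Fin K) (Fin K) ℝ) (μ : Fin K → ℝ)
  (prev : Fin K → Fin K) (uL : Fin J → ℝ)

theorem uvec_emb (j : Fin J) : uvec hJK P μ prev uL (emb hJK j) = uL j :=
  dif_pos j.2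

theorem uvec_Hty (h : Hty K J) : uvec hJK P μ prev uL h = uHvec hJK P μ prev uL h :=
  dif_neg (not_lt.2 h.2)

/-- The `ℋ`-block of `Aᵀ u` vanishes. -/
theorem Amat_transpose_mulVec_uvec (hAH : IsUnit (AHmat K J P μ prev)) (h : Hty K J) :
    ((Amat K J P μ prev)ᵀ *ᵥ uvec hJK P μ prev uL) h = 0 := by
  have hdet : IsUnit (AHmat K J P μ prev)ᵀ.det := by
    rw [Matrix.det_transpose]
    exact (Matrix.isUnit_iff_isUnit_det _).1 hAH
  have key : (ALHmat hJK P μ prev)ᵀ *ᵥ uL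
      + (AHmat K J P μ prev)ᵀ *ᵥ uHvec hJK P μ prev uL = 0 := by
    rw [uHvec, Matrix.mulVec_neg, Matrix.mulVec_mulVec, Matrix.transpose_nonsing_inv,
      Matrix.mul_nonsing_inv _ hdet, Matrix.one_mulVec, add_neg_cancel]
  have hk := congrFun key h
  simp only [Pi.add_apply, Matrix.mulVec, dotProduct, Pi.zero_apply] at hk ⊢
  rw [sum_eq_sum_emb_add_sum_Hty hJK]
  simp only [uvec_emb, uvec_Hty]
  exact hk

theorem one_sub_Bmat_transpose_mulVec (v : Fin K → ℝ) (c : Fin K) (hc : J ≤ (c : ℕ)) :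
    ((1 - Bmat K J prev)ᵀ *ᵥ v) c = v c - v (prev c) := by
  rw [Matrix.transpose_sub, Matrix.transpose_one, Matrix.sub_mulVec, Matrix.one_mulVec,
    Pi.sub_apply]
  congr 1
  simp [Matrix.mulVec, dotProduct, Bmat, hc]

theorem diagonal_mul_one_sub_mulVec_uvec_prev (hAH : IsUnit (AHmat K J P μ prev))
    (c : Fin K) (hc : J ≤ (c : ℕ)) :
    ((Matrix.diagonal μ * (1 - P)) *ᵥ uvec hJK P μ prev uL) (prev c)
      = ((Matrix.diagonal μ * (1 - P)) *ᵥ uvec hJK P μ prev uL) c := by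
  have h := Amat_transpose_mulVec_uvec hJK P μ prev uL hAH ⟨c, hc⟩
  have hA : (Amat K J P μ prev)ᵀ
      = (1 - Bmat K J prev)ᵀ * (Matrix.diagonal μ * (1 - P)) := by
    simp [Amat, Matrix.transpose_mul]
  rw [hA, ← Matrix.mulVec_mulVec, one_sub_Bmat_transpose_mulVec _ _ _ hc] at h
  exact (sub_eq_zero.1 h).symm

theorem one_sub_mulVec_uvec_emb (j : Fin J) :
    ((1 - P) *ᵥ uvec hJK P μ prev uL) (emb hJK j)
      = ((1 - Qmat hJK P μ prev) *ᵥ uL) j := by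
  have hPu : (P *ᵥ uvec hJK P μ prev uL) (emb hJK j) = (Qmat hJK P μ prev *ᵥ uL) j := by
    have hQ : Qmat hJK P μ prev *ᵥ uL
        = (Matrix.of fun i j => P (emb hJK i) (emb hJK j)) *ᵥ uL
          + (Matrix.of fun (i : Fin J) (h : Hty K J) => P (emb hJK i) h) *ᵥ
            uHvec hJK P μ prev uL := by
      rw [Qmat, uHvec, Matrix.sub_mulVec, Matrix.mulVec_neg, Matrix.mulVec_mulVec,
        Matrix.mulVec_mulVec, Matrix.mul_assoc, sub_eq_add_neg]
    rw [hQ]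
    simp only [Pi.add_apply, Matrix.mulVec, dotProduct, Matrix.of_apply]
    rw [sum_eq_sum_emb_add_sum_Hty hJK]
    simp only [uvec_emb, uvec_Hty]
  rw [Matrix.sub_mulVec, Matrix.sub_mulVec, Matrix.one_mulVec, Matrix.one_mulVec,
    Pi.sub_apply, Pi.sub_apply, hPu, uvec_emb]

theorem diagonal_mul_one_sub_mulVec_uvec (s : Fin K → Fin J)
    (hchain : ∀ c : Fin K, ∃ n : ℕ,
      (fun x : Fin K => if J ≤ (x : ℕ) then prev x else x)^[n] c = emb hJK (s c))
    (hAH : IsUnit (AHmat K J P μ prev)) :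
    (Matrix.diagonal μ * (1 - P)) *ᵥ uvec hJK P μ prev uL
      = ((Cmat K J s)ᵀ * Matrix.diagonal (fun j : Fin J => μ (emb hJK j)) *
          (1 - Qmat hJK P μ prev)) *ᵥ uL := by
  set v := (Matrix.diagonal μ * (1 - P)) *ᵥ uvec hJK P μ prev uL with hv
  have hiter : ∀ (n : ℕ) (c : Fin K),
      v ((fun x : Fin K => if J ≤ (x : ℕ) then prev x else x)^[n] c) = v c := by
    intro n
    induction n with
    | zero => exact fun _ => rfl
    | succ n ih =>
      intro c
      rw [Function.iterate_succ_apply, ih]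
      split_ifs with hc
      · exact diagonal_mul_one_sub_mulVec_uvec_prev hJK P μ prev uL hAH c hc
      · rfl
  ext c
  obtain ⟨n, hn⟩ := hchain c
  rw [← hiter n c, hn, hv, ← Matrix.mulVec_mulVec, Matrix.mulVec_diagonal,
    one_sub_mulVec_uvec_emb, ← Matrix.mulVec_mulVec, ← Matrix.mulVec_mulVec]
  simp [Matrix.mulVec, dotProduct, Cmat, Matrix.diagonal_apply]

end

theorem stmt8 (K J : ℕ) (hJ : 1 ≤ J) (hJK : J ≤ K)
    (s : Fin K → Fin J) (prev : Fin K → Fin K)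
    (hs : ∀ j : Fin J, s (emb hJK j) = j)
    (hprev_station : ∀ c : Fin K, J ≤ (c : ℕ) → s (prev c) = s c)
    (hprev_inj : ∀ c c' : Fin K, J ≤ (c : ℕ) → J ≤ (c' : ℕ) → prev c = prev c' → c = c')
    (hchain : ∀ c : Fin K, ∃ n : ℕ,
      (fun x : Fin K => if J ≤ (x : ℕ) then prev x else x)^[n] c = emb hJK (s c))
    (P : Matrix (Fin K) (Fin K) ℝ) (hP : IsUnit (1 - P))
    (μ : Fin K → ℝ) (hμ : ∀ l, 0 < μ l)
    (hAH : IsUnit (AHmat K J P μ prev))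
    (k : Fin J)
    (hQ : IsUnit (1 - Qlow (Qmat hJK P μ prev) k)) :
    (Matrix.diagonal μ * (1 - P)).mulVec
        (uvec hJK P μ prev (uLvec (Qmat hJK P μ prev) k))
      = ((Cmat K J s)ᵀ * Matrix.diagonal (fun j : Fin J => μ (emb hJK j)) *
          (1 - Qmat hJK P μ prev)).mulVec (uLvec (Qmat hJK P μ prev) k) ∧
    uvec hJK P μ prev (uLvec (Qmat hJK P μ prev) k)
      = ((1 - P)⁻¹ * Matrix.diagonal (fun l : Fin K => (μ l)⁻¹) * (Cmat K J s)ᵀ *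
          Matrix.diagonal (fun j : Fin J => μ (emb hJK j)) *
          (1 - Qmat hJK P μ prev)).mulVec (uLvec (Qmat hJK P μ prev) k) := by
  have h := diagonal_mul_one_sub_mulVec_uvec hJK P μ prev (uLvec (Qmat hJK P μ prev) k)
    s hchain hAH
  refine ⟨h, ?_⟩
  have hinv : Matrix.diagonal (fun l => (μ l)⁻¹) * Matrix.diagonal μ = 1 := by
    rw [Matrix.diagonal_mul_diagonal, ← Matrix.diagonal_one]
    congr 1
    ext l
    exact inv_mul_cancel₀ (hμ l).ne'
  have hdet : IsUnit (1 - P).det := (Matrix.isUnit_iff_isUnit_det _).1 hP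
  have h' := congrArg
    (fun x => ((1 - P)⁻¹ * Matrix.diagonal (fun l : Fin K => (μ l)⁻¹)) *ᵥ x) h
  simp only [Matrix.mulVec_mulVec] at h'
  rw [Matrix.mul_assoc (1 - P)⁻¹, ← Matrix.mul_assoc (Matrix.diagonal _) (Matrix.diagonal μ),
    hinv, Matrix.one_mul, Matrix.nonsing_inv_mul _ hdet, Matrix.one_mulVec] at h'
  simpa only [Matrix.mul_assoc] using h'
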